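/- Duality bound for linear spectral statistics: Let μ′ be a finite signed measure on ℝ, b(φ) := ∫ φ dμ′, and β(z) := ∫ dμ′(t)/(z−t). Then for s > 1/2 and every Schwartz function φ, |b(φ)| ≤ (‖φ‖_{H_s} / (2π^{3/2} Γ(2s)^{1/2})) · (∫₀^∞ e^{−y} y^{2s−1} ∫_ℝ |β(x+iy)|² dx dy)^{1/2}. -/

import Mathlib

open MeasureTheory FourierTransform
open scoped ContDiff SchwartzMap

lemma bdb_plancherel (f : ℝ → ℂ) (hf : Integrable f) (h2 : MemLp f 2) :
    ∫ x, ‖𝓕 f x‖ ^ 2 = ∫ x, ‖f x‖ ^ 2 := by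
  set F : Lp ℂ 2 (volume : Measure ℝ) := h2.toLp f with hF
  have hcont : Continuous (𝓕 f) := by
    exact VectorFourier.fourierIntegral_continuous Real.continuous_fourierChar
      (by exact continuous_inner) hf
  have hae : ∀ᵐ x, (𝓕 F : Lp ℂ 2 (volume : Measure ℝ)) x = 𝓕 f x := by
    apply ae_eq_of_integral_contDiff_smul_eq
    · exact (Lp.memLp _).locallyIntegrable (by norm_num)
    · exact hcont.locallyIntegrable
    · intro g g_smooth g_cpt
      have hg₁ : HasCompactSupport (Complex.ofRealCLM ∘ g) := g_cpt.comp_left rfl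
      have hg₂ : ContDiff ℝ ∞ (Complex.ofRealCLM ∘ g) := by fun_prop
      set G : 𝓢(ℝ, ℂ) := hg₁.toSchwartzMap hg₂ with hG
      have h1 : ∫ x, g x • (𝓕 F : Lp ℂ 2 (volume : Measure ℝ)) x
          = Lp.toTemperedDistribution (𝓕 F : Lp ℂ 2 (volume : Measure ℝ)) G := by
        simp [hG]
      rw [h1, ← Lp.fourier_toTemperedDistribution_eq, TemperedDistribution.fourier_apply,
        Lp.toTemperedDistribution_apply]
      have h3 : ∫ x, (𝓕 G) x • F x = ∫ x, (𝓕 G) x • f x := by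
        apply integral_congr_ae
        filter_upwards [h2.coeFn_toLp] with x hx
        rw [hF, hx]
      rw [h3]
      have h4 := VectorFourier.integral_fourierIntegral_smul_eq_flip (L := innerₗ ℝ) (μ := volume)
        (ν := volume) (f := (G : ℝ → ℂ)) (g := f)
        Real.continuous_fourierChar continuous_inner G.integrable hf
      have h5 : ∫ x, g x • 𝓕 f x = ∫ x, G x • 𝓕 f x := by simp [hG]
      rw [h5]
      simpa using! h4
  have e1 : ∫ x, ‖𝓕 f x‖ ^ 2 = ∫ x, ‖(𝓕 F : Lp ℂ 2 (volume : Measure ℝ)) x‖ ^ 2 := by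
    apply integral_congr_ae
    filter_upwards [hae] with x hx
    simp only [hx]
  have e2 : ∫ x, ‖f x‖ ^ 2 = ∫ x, ‖F x‖ ^ 2 := by
    apply integral_congr_ae
    filter_upwards [h2.coeFn_toLp] with x hx
    simp only [hF, hx]
  have e3 : ∀ H : Lp ℂ 2 (volume : Measure ℝ), ∫ x, ‖H x‖ ^ 2 = ‖H‖ ^ 2 := by
    intro H
    have := L2.inner_def (𝕜 := ℂ) H H
    rw [inner_self_eq_norm_sq_to_K] at this
    simp only [inner_self_eq_norm_sq_to_K] at this
    have h := congrArg Complex.re this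
    norm_cast at h
    exact h.symm
  rw [e1, e2, e3, e3, Lp.norm_fourier_eq]

lemma bdb_kernel (μ : Measure ℝ) [IsFiniteMeasure μ] (x y : ℝ) (hy : 0 < y) :
    ∫ t in Set.Ioi (0 : ℝ), Complex.exp (Complex.I * t * x) * (charFun μ (-t) * Real.exp (-(y * t)))
      = Complex.I * ∫ u : ℝ, ((x : ℂ) + y * Complex.I - (u : ℂ))⁻¹ ∂μ := by
  have key : ∀ u : ℝ, (Complex.I * ((x : ℂ) + y * Complex.I - u)).re = -y := by
    intro u; simp
  have hint : Integrable (Function.uncurry fun (t u : ℝ) =>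
      Complex.exp (Complex.I * ((x : ℂ) + y * Complex.I - u) * t))
      ((volume.restrict (Set.Ioi (0 : ℝ))).prod μ) := by
    have h0 : Integrable (fun p : ℝ × ℝ => Real.exp (-y * p.1) * (1 : ℝ))
        ((volume.restrict (Set.Ioi (0 : ℝ))).prod μ) :=
      Integrable.mul_prod (f := fun t : ℝ => Real.exp (-y * t)) (g := fun _ => (1 : ℝ))
        (exp_neg_integrableOn_Ioi 0 hy) (integrable_const _)
    refine h0.mono' (by
      apply Continuous.aestronglyMeasurable
      unfold Function.uncurry
      fun_prop) (Filter.Eventually.of_forall ?_)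
    rintro ⟨t, u⟩
    simp only [Function.uncurry, Complex.norm_exp, Complex.re_mul_ofReal, key, mul_one]
    rfl
  calc _ = ∫ t in Set.Ioi (0 : ℝ), ∫ u : ℝ,
        Complex.exp (Complex.I * ((x : ℂ) + y * Complex.I - u) * t) ∂μ := by
        apply integral_congr_ae
        refine Filter.Eventually.of_forall fun t => ?_
        simp only [charFun_apply_real]
        rw [← integral_mul_const, ← integral_const_mul]
        congr 1
        ext u
        rw [Complex.ofReal_exp, ← Complex.exp_add, ← Complex.exp_add]
        congr 1
        push_cast
        linear_combination (-(y : ℂ) * t) * Complex.I_sq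
    _ = ∫ u : ℝ, (∫ t in Set.Ioi (0 : ℝ),
        Complex.exp (Complex.I * ((x : ℂ) + y * Complex.I - u) * t)) ∂μ :=
        integral_integral_swap hint
    _ = _ := by
        rw [← integral_const_mul]
        congr 1
        ext u
        rw [integral_exp_mul_complex_Ioi (by rw [key]; linarith)]
        have hne : (x : ℂ) + y * Complex.I - u ≠ 0 := by
          intro h
          have := key u
          rw [h] at this
          simp at this
          linarith
        simp only [Complex.ofReal_zero, mul_zero, Complex.exp_zero]
        field_simp
        simp [neg_div, one_div]

/-- The Fourier transform of the signed measure. -/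
noncomputable def bdbA (μ₁ μ₂ : Measure ℝ) (t : ℝ) : ℂ := charFun μ₁ (-t) - charFun μ₂ (-t)

lemma bdbA_continuous (μ₁ μ₂ : Measure ℝ) [IsFiniteMeasure μ₁] [IsFiniteMeasure μ₂] :
    Continuous (bdbA μ₁ μ₂) := by
  unfold bdbA
  exact (continuous_charFun.comp continuous_neg).sub (continuous_charFun.comp continuous_neg)

lemma bdbA_bound (μ₁ μ₂ : Measure ℝ) (t : ℝ) :
    ‖bdbA μ₁ μ₂ t‖ ≤ μ₁.real Set.univ + μ₂.real Set.univ :=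
  (norm_sub_le _ _).trans (add_le_add (norm_charFun_le _) (norm_charFun_le _))

lemma bdbA_neg (μ₁ μ₂ : Measure ℝ) (t : ℝ) : ‖bdbA μ₁ μ₂ (-t)‖ = ‖bdbA μ₁ μ₂ t‖ := by
  unfold bdbA
  rw [charFun_neg (-t), charFun_neg (-t), ← map_sub, RCLike.norm_conj]

lemma bdbA_abs (μ₁ μ₂ : Measure ℝ) (t : ℝ) : ‖bdbA μ₁ μ₂ |t|‖ = ‖bdbA μ₁ μ₂ t‖ := by
  rcases abs_choice t with h | h <;> rw [h]
  exact bdbA_neg _ _ _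

lemma bdb_parseval (μ₁ μ₂ : Measure ℝ) [IsFiniteMeasure μ₁] [IsFiniteMeasure μ₂]
    (y : ℝ) (hy : 0 < y) :
    ∫ x : ℝ, ‖(∫ t : ℝ, ((x : ℂ) + y * Complex.I - (t : ℂ))⁻¹ ∂μ₁)
                - ∫ t : ℝ, ((x : ℂ) + y * Complex.I - (t : ℂ))⁻¹ ∂μ₂‖ ^ 2
      = 2 * Real.pi * ∫ t in Set.Ioi (0 : ℝ), ‖bdbA μ₁ μ₂ t‖ ^ 2 * Real.exp (-(2 * y * t)) := by
  set C := μ₁.real Set.univ + μ₂.real Set.univ with hC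
  set g : ℝ → ℂ := fun t => bdbA μ₁ μ₂ t * Real.exp (-(y * t)) with hg
  have hgc : Continuous g := by
    have := bdbA_continuous μ₁ μ₂
    fun_prop
  set G : ℝ → ℂ := (Set.Ioi (0 : ℝ)).indicator g with hG
  have hgn : ∀ t, ‖g t‖ ≤ C * Real.exp (-y * t) := by
    intro t
    simp only [hg, norm_mul, Complex.norm_real, Real.norm_eq_abs, Real.abs_exp, neg_mul]
    gcongr
    exact bdbA_bound _ _ _
  have hgi : IntegrableOn g (Set.Ioi 0) :=
    Integrable.mono' ((exp_neg_integrableOn_Ioi 0 hy).const_mul C)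
      hgc.aestronglyMeasurable (Filter.Eventually.of_forall hgn)
  have hGi : Integrable G := by
    rw [hG, integrable_indicator_iff measurableSet_Ioi]; exact hgi
  have hGb : ∀ t, ‖G t‖ ≤ C := by
    intro t
    have hC0 : 0 ≤ C := by positivity
    by_cases ht : t ∈ Set.Ioi (0 : ℝ)
    · rw [hG, Set.indicator_of_mem ht]
      refine (hgn t).trans ?_
      have : Real.exp (-y * t) ≤ 1 := by
        rw [Real.exp_le_one_iff]
        have : 0 < y * t := mul_pos hy ht
        linarith
      nlinarith
    · rw [hG, Set.indicator_of_notMem ht]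
      simpa using hC0
  have hG2 : MemLp G 2 := by
    rw [memLp_two_iff_integrable_sq_norm hGi.aestronglyMeasurable]
    refine (hGi.norm.const_mul C).mono' (hGi.aestronglyMeasurable.norm.pow 2)
      (Filter.Eventually.of_forall fun t => ?_)
    rw [Real.norm_eq_abs, abs_of_nonneg (by positivity), sq]
    exact mul_le_mul_of_nonneg_right (hGb t) (norm_nonneg _)
  have hk : ∀ x : ℝ, ‖(∫ t : ℝ, ((x : ℂ) + y * Complex.I - (t : ℂ))⁻¹ ∂μ₁)
                - ∫ t : ℝ, ((x : ℂ) + y * Complex.I - (t : ℂ))⁻¹ ∂μ₂‖ ^ 2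
      = (fun ξ => ‖𝓕 G ξ‖ ^ 2) (x / (-(2 * Real.pi))) := by
    intro x
    have e : 𝓕 G (x / (-(2 * Real.pi))) = Complex.I * ((∫ t : ℝ, ((x : ℂ) + y * Complex.I - (t : ℂ))⁻¹ ∂μ₁)
                - ∫ t : ℝ, ((x : ℂ) + y * Complex.I - (t : ℂ))⁻¹ ∂μ₂) := by
      rw [mul_sub, ← bdb_kernel μ₁ x y hy, ← bdb_kernel μ₂ x y hy, Real.fourier_real_eq_integral_exp_smul]
      have hi : ∀ μ : Measure ℝ, IsFiniteMeasure μ → IntegrableOn (fun t : ℝ =>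
          Complex.exp (Complex.I * t * x) * (charFun μ (-t) * Real.exp (-(y * t)))) (Set.Ioi 0) := by
        intro μ _
        have hc : Continuous (fun t : ℝ => charFun μ (-t)) :=
          continuous_charFun.comp continuous_neg
        refine Integrable.mono' ((exp_neg_integrableOn_Ioi 0 hy).const_mul (μ.real Set.univ))
          (Continuous.aestronglyMeasurable (by fun_prop)) (Filter.Eventually.of_forall fun t => ?_)
        have : Complex.exp (Complex.I * t * x) = Complex.exp ((t * x : ℝ) * Complex.I) := by
          congr 1; push_cast; ring
        rw [norm_mul, this, Complex.norm_exp_ofReal_mul_I, one_mul, norm_mul, Complex.norm_real,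
          Real.norm_eq_abs, Real.abs_exp, neg_mul]
        gcongr
        exact norm_charFun_le _
      rw [← integral_sub (hi μ₁ inferInstance) (hi μ₂ inferInstance),
        ← integral_indicator measurableSet_Ioi]
      congr 1
      ext t
      by_cases ht : t ∈ Set.Ioi (0 : ℝ)
      · rw [hG, Set.indicator_of_mem ht, Set.indicator_of_mem ht, smul_eq_mul]
        have : ((-2 * Real.pi * t * (x / (-(2 * Real.pi))) : ℝ) : ℂ) * Complex.I
            = Complex.I * t * x := by
          have hp : -2 * Real.pi * t * (x / (-(2 * Real.pi))) = t * x := by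
            field_simp
          rw [hp]; push_cast; ring
        rw [this, hg]
        simp only [bdbA]
        ring
      · rw [hG, Set.indicator_of_notMem ht, Set.indicator_of_notMem ht, smul_zero]
    simp only [e, norm_mul, Complex.norm_I, one_mul]
  simp_rw [hk]
  rw [Measure.integral_comp_div (fun ξ => ‖𝓕 G ξ‖ ^ 2), bdb_plancherel G hGi hG2, abs_neg, abs_of_pos (by positivity), smul_eq_mul,
    ← integral_indicator measurableSet_Ioi]
  congr 2
  ext t
  by_cases ht : t ∈ Set.Ioi (0 : ℝ)
  · rw [hG, Set.indicator_of_mem ht, Set.indicator_of_mem ht, hg]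
    simp only [norm_mul, Complex.norm_real, Real.norm_eq_abs, Real.abs_exp, mul_pow]
    rw [← Real.exp_nat_mul]
    congr 2
    push_cast; ring
  · rw [hG, Set.indicator_of_notMem ht, Set.indicator_of_notMem ht]; simp

lemma bdb_integrable_weight (s : ℝ) (hs : 1 / 2 < s) :
    Integrable (fun t : ℝ => (1 + 2 * |t|) ^ (-(2 * s))) := by
  have h : Integrable (fun t : ℝ => (1 + ‖t‖) ^ (-(2 * s))) :=
    integrable_one_add_norm (by simp; linarith)
  have := h.comp_mul_left' (R := 2) (by norm_num)
  simpa [abs_mul] using this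

lemma bdb_gamma (μ₁ μ₂ : Measure ℝ) [IsFiniteMeasure μ₁] [IsFiniteMeasure μ₂]
    (s : ℝ) (hs : 1 / 2 < s) :
    ∫ y in Set.Ioi (0 : ℝ), Real.exp (-y) * y ^ (2 * s - 1) *
        ∫ t in Set.Ioi (0 : ℝ), ‖bdbA μ₁ μ₂ t‖ ^ 2 * Real.exp (-(2 * y * t))
      = Real.Gamma (2 * s) * ∫ t in Set.Ioi (0 : ℝ), (1 + 2 * t) ^ (-(2 * s)) * ‖bdbA μ₁ μ₂ t‖ ^ 2 := by
  have hA := bdbA_continuous μ₁ μ₂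
  set K : ℝ → ℝ → ℝ := fun y t =>
    ‖bdbA μ₁ μ₂ t‖ ^ 2 * (y ^ (2 * s - 1) * Real.exp (-((1 + 2 * t) * y))) with hK
  have hKt : ∀ t ∈ Set.Ioi (0 : ℝ), ∫ y in Set.Ioi (0 : ℝ), K y t
      = Real.Gamma (2 * s) * ((1 + 2 * t) ^ (-(2 * s)) * ‖bdbA μ₁ μ₂ t‖ ^ 2) := by
    intro t ht
    have ht' : (0 : ℝ) < t := ht
    simp only [hK]
    rw [integral_const_mul, Real.integral_rpow_mul_exp_neg_mul_Ioi (by linarith) (by linarith),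
      one_div, Real.inv_rpow (by linarith), Real.rpow_neg (by linarith)]
    ring
  have hwi : IntegrableOn (fun t : ℝ => (1 + 2 * t) ^ (-(2 * s)) * ‖bdbA μ₁ μ₂ t‖ ^ 2) (Set.Ioi 0) := by
    have h1 : IntegrableOn (fun t : ℝ => (μ₁.real Set.univ + μ₂.real Set.univ) ^ 2 *
        (1 + 2 * |t|) ^ (-(2 * s))) (Set.Ioi 0) :=
      ((bdb_integrable_weight s hs).const_mul _).integrableOn
    refine Integrable.mono' h1 (Measurable.aestronglyMeasurable ?_) ?_
    · have := hA.measurable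
      fun_prop
    · filter_upwards [ae_restrict_mem measurableSet_Ioi] with t ht
      have ht' : (0 : ℝ) < t := ht
      have hp : 0 ≤ (1 + 2 * t) ^ (-(2 * s)) := by positivity
      rw [abs_of_pos ht', Real.norm_eq_abs, abs_of_nonneg (by positivity), mul_comm]
      gcongr
      exact bdbA_bound _ _ _
  have hint : Integrable (Function.uncurry K)
      ((volume.restrict (Set.Ioi (0 : ℝ))).prod (volume.restrict (Set.Ioi (0 : ℝ)))) := by
    have hm : Measurable (Function.uncurry K) := by
      have := hA.measurable
      simp only [hK, Function.uncurry_def]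
      fun_prop
    rw [integrable_prod_iff' hm.aestronglyMeasurable]
    constructor
    · filter_upwards [ae_restrict_mem measurableSet_Ioi] with t ht
      have ht' : (0 : ℝ) < t := ht
      simp only [hK, Function.uncurry]
      apply Integrable.const_mul
      have := integrableOn_rpow_mul_exp_neg_mul_rpow (s := 2 * s - 1) (p := 1) (b := 1 + 2 * t) (by linarith) (by norm_num) (by linarith)
      simpa only [IntegrableOn, Real.rpow_one, neg_mul] using this
    · refine (hwi.const_mul (Real.Gamma (2 * s))).congr ?_
      filter_upwards [ae_restrict_mem measurableSet_Ioi] with t ht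
      rw [← hKt t ht]
      apply setIntegral_congr_fun measurableSet_Ioi
      intro y hy
      have hy' : (0 : ℝ) < y := hy
      simp only [hK, Function.uncurry]
      rw [Real.norm_eq_abs, abs_of_nonneg (by positivity)]
  calc _ = ∫ y in Set.Ioi (0 : ℝ), ∫ t in Set.Ioi (0 : ℝ), K y t := by
        congr 1
        ext y
        rw [← integral_const_mul]
        congr 1
        ext t
        have : Real.exp (-((1 + 2 * t) * y)) = Real.exp (-y) * Real.exp (-(2 * y * t)) := by
          rw [← Real.exp_add]; congr 1; ring
        simp only [hK, this]
        ring
    _ = ∫ t in Set.Ioi (0 : ℝ), ∫ y in Set.Ioi (0 : ℝ), K y t := integral_integral_swap hint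
    _ = _ := by
        rw [← integral_const_mul]
        exact setIntegral_congr_fun measurableSet_Ioi hKt

lemma bdb_beta (μ₁ μ₂ : Measure ℝ) [IsFiniteMeasure μ₁] [IsFiniteMeasure μ₂]
    (s : ℝ) (hs : 1 / 2 < s) :
    ∫ y in Set.Ioi (0 : ℝ), Real.exp (-y) * y ^ (2 * s - 1)
            * ∫ x : ℝ, ‖(∫ t : ℝ, ((x : ℂ) + y * Complex.I - (t : ℂ))⁻¹ ∂μ₁)
                - ∫ t : ℝ, ((x : ℂ) + y * Complex.I - (t : ℂ))⁻¹ ∂μ₂‖ ^ 2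
      = Real.pi * Real.Gamma (2 * s) * ∫ t : ℝ, (1 + 2 * |t|) ^ (-(2 * s)) * ‖bdbA μ₁ μ₂ t‖ ^ 2 := by
  have h1 : ∫ t : ℝ, (1 + 2 * |t|) ^ (-(2 * s)) * ‖bdbA μ₁ μ₂ t‖ ^ 2
      = 2 * ∫ t in Set.Ioi (0 : ℝ), (1 + 2 * t) ^ (-(2 * s)) * ‖bdbA μ₁ μ₂ t‖ ^ 2 := by
    rw [← integral_comp_abs (f := fun t => (1 + 2 * t) ^ (-(2 * s)) * ‖bdbA μ₁ μ₂ t‖ ^ 2)]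
    simp only [bdbA_abs]
  rw [h1]
  have h2 := bdb_gamma μ₁ μ₂ s hs
  calc _ = ∫ y in Set.Ioi (0 : ℝ), 2 * Real.pi * (Real.exp (-y) * y ^ (2 * s - 1) *
        ∫ t in Set.Ioi (0 : ℝ), ‖bdbA μ₁ μ₂ t‖ ^ 2 * Real.exp (-(2 * y * t))) := by
        apply setIntegral_congr_fun measurableSet_Ioi
        intro y hy
        simp only
        rw [bdb_parseval μ₁ μ₂ y hy]
        ring
    _ = _ := by
        rw [integral_const_mul, h2]; ring

/-- The Fourier transform with the convention of the statement. -/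
noncomputable def bdbH (φ : SchwartzMap ℝ ℂ) (t : ℝ) : ℂ :=
  ∫ x : ℝ, Complex.exp (-Complex.I * (t : ℂ) * (x : ℂ)) * φ x

lemma bdbH_eq (φ : SchwartzMap ℝ ℂ) (t : ℝ) :
    bdbH φ t = (𝓕 φ) (t / (2 * Real.pi)) := by
  rw [SchwartzMap.fourier_coe, Real.fourier_real_eq_integral_exp_smul, bdbH]
  congr 1
  ext x
  rw [smul_eq_mul]
  congr 2
  have hp : -2 * Real.pi * x * (t / (2 * Real.pi)) = -(t * x) := by field_simp
  rw [hp]; push_cast; ring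

lemma bdbH_integrable (φ : SchwartzMap ℝ ℂ) : Integrable (bdbH φ) := by
  have : bdbH φ = fun t => (𝓕 φ) (t / (2 * Real.pi)) := funext (bdbH_eq φ)
  rw [this]
  exact (𝓕 φ).integrable.comp_div (by positivity)

lemma bdbH_continuous (φ : SchwartzMap ℝ ℂ) : Continuous (bdbH φ) := by
  have : bdbH φ = fun t => (𝓕 φ) (t / (2 * Real.pi)) := funext (bdbH_eq φ)
  rw [this]
  exact (𝓕 φ).continuous.comp (continuous_id.div_const _)

lemma bdb_inv (φ : SchwartzMap ℝ ℂ) (x : ℝ) :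
    φ x = (2 * Real.pi : ℝ)⁻¹ * ∫ t : ℝ, Complex.exp (t * x * Complex.I) * bdbH φ t := by
  have h : φ x = (𝓕⁻ (𝓕 φ)) x := by rw [FourierTransform.fourierInv_fourier_eq]
  rw [h, SchwartzMap.fourierInv_coe, Real.fourierInv_eq']
  have h2 := Measure.integral_comp_div
    (fun v : ℝ => Complex.exp ((↑(2 * Real.pi * inner ℝ v x) * Complex.I)) • (𝓕 φ) v) (2 * Real.pi)
  have h3 : ∫ t : ℝ, Complex.exp (t * x * Complex.I) * bdbH φ t = (2 * Real.pi) • ∫ v : ℝ, Complex.exp ((↑(2 * Real.pi * inner ℝ v x) * Complex.I)) • (𝓕 φ) v := by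
    rw [abs_of_pos (by positivity)] at h2
    rw [← h2]
    congr 1
    ext t
    rw [bdbH_eq, smul_eq_mul]
    congr 2
    have hp : 2 * Real.pi * inner ℝ (t / (2 * Real.pi)) x = t * x := by
      simp; field_simp
    rw [hp]; push_cast; ring
  rw [h3, Complex.real_smul, ← mul_assoc, ← Complex.ofReal_mul, inv_mul_cancel₀ (by positivity)]
  simp

lemma bdb_pair (μ : Measure ℝ) [IsFiniteMeasure μ] (φ : SchwartzMap ℝ ℂ) :
    ∫ x, φ x ∂μ = (2 * Real.pi : ℝ)⁻¹ * ∫ t : ℝ, charFun μ t * bdbH φ t := by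
  have hint : Integrable (Function.uncurry fun (x t : ℝ) =>
      Complex.exp (t * x * Complex.I) * bdbH φ t) (μ.prod volume) := by
    have h0 : Integrable (fun p : ℝ × ℝ => (1 : ℝ) * ‖bdbH φ p.2‖) (μ.prod volume) :=
      Integrable.mul_prod (f := fun _ : ℝ => (1 : ℝ)) (g := fun t => ‖bdbH φ t‖)
        (integrable_const _) (bdbH_integrable φ).norm
    have hc := bdbH_continuous φ
    refine h0.mono' (by
      apply Continuous.aestronglyMeasurable
      unfold Function.uncurry
      fun_prop) (Filter.Eventually.of_forall ?_)
    rintro ⟨x, t⟩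
    simp only [Function.uncurry]
    rw [norm_mul, ← Complex.ofReal_mul, Complex.norm_exp_ofReal_mul_I]
  calc _ = ∫ x : ℝ, ((2 * Real.pi : ℝ)⁻¹ * ∫ t : ℝ, Complex.exp (t * x * Complex.I) * bdbH φ t) ∂μ := by
        congr 1; ext x; exact bdb_inv φ x
    _ = _ := by
        rw [integral_const_mul, integral_integral_swap hint]
        congr 2
        ext t
        rw [charFun_apply_real, integral_mul_const]

lemma bdb_pair_bound (μ₁ μ₂ : Measure ℝ) [IsFiniteMeasure μ₁] [IsFiniteMeasure μ₂]
    (φ : SchwartzMap ℝ ℂ) :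
    ‖(∫ x : ℝ, φ x ∂μ₁) - ∫ x : ℝ, φ x ∂μ₂‖
      ≤ (2 * Real.pi)⁻¹ * ∫ t : ℝ, ‖bdbH φ t‖ * ‖bdbA μ₁ μ₂ t‖ := by
  have hi : ∀ μ : Measure ℝ, IsFiniteMeasure μ → Integrable (fun t => charFun μ t * bdbH φ t) := by
    intro μ _
    exact (bdbH_integrable φ).bdd_mul continuous_charFun.aestronglyMeasurable
      (Filter.Eventually.of_forall fun t => norm_charFun_le t)
  rw [bdb_pair, bdb_pair, ← mul_sub, ← integral_sub (hi _ inferInstance) (hi _ inferInstance),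
    norm_mul, Complex.norm_real, Real.norm_eq_abs, abs_of_pos (by positivity)]
  gcongr
  refine (norm_integral_le_integral_norm _).trans (le_of_eq ?_)
  congr 1
  ext t
  rw [← sub_mul, norm_mul, mul_comm, ← bdbA_neg]
  simp [bdbA]

lemma bdb_Hs_integrable (s : ℝ) (hs : 1 / 2 < s) (φ : SchwartzMap ℝ ℂ) :
    Integrable (fun t : ℝ => (1 + 2 * |t|) ^ (2 * s) * ‖bdbH φ t‖ ^ 2) := by
  obtain ⟨k, hk⟩ := exists_nat_ge (2 * s)
  obtain ⟨C, hC⟩ : ∃ C, ∀ x, ‖(𝓕 φ) x‖ ≤ C := by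
    obtain ⟨C, -, hC⟩ := (𝓕 φ).decay 0 0
    exact ⟨C, fun x => by simpa using hC x⟩
  have hC0 : 0 ≤ C := (norm_nonneg _).trans (hC 0)
  set c : ℝ := 4 * Real.pi with hc
  have hcp : 0 < c := by positivity
  have hmain : Integrable (fun u : ℝ => (1 + c * |u|) ^ (2 * s) * ‖(𝓕 φ) u‖ ^ 2) := by
    have h1 := ((𝓕 φ).integrable_pow_mul volume 0).const_mul (2 ^ (k - 1) * C)
    have h2 := ((𝓕 φ).integrable_pow_mul volume k).const_mul (2 ^ (k - 1) * C * c ^ k)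
    refine (h1.add h2).mono' (Measurable.aestronglyMeasurable ?_)
      (Filter.Eventually.of_forall fun u => ?_)
    · have := (𝓕 φ).continuous.measurable
      fun_prop
    · rw [Real.norm_eq_abs, abs_of_nonneg (by positivity)]
      have e1 : (1 + c * |u|) ^ (2 * s) ≤ 2 ^ (k - 1) * (1 + c ^ k * |u| ^ k) := by
        calc (1 + c * |u|) ^ (2 * s) ≤ (1 + c * |u|) ^ (k : ℝ) :=
              Real.rpow_le_rpow_of_exponent_le (by have := abs_nonneg u; nlinarith) hk
          _ = (1 + c * |u|) ^ k := Real.rpow_natCast _ _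
          _ ≤ 2 ^ (k - 1) * (1 ^ k + (c * |u|) ^ k) := add_pow_le (by norm_num) (by positivity) k
          _ = _ := by rw [one_pow, mul_pow]
      have e2 : ‖(𝓕 φ) u‖ ^ 2 ≤ C * ‖(𝓕 φ) u‖ := by
        rw [sq]; exact mul_le_mul_of_nonneg_right (hC u) (norm_nonneg _)
      refine (mul_le_mul e1 e2 (by positivity) (by positivity)).trans (le_of_eq ?_)
      simp only [Pi.add_apply, Real.norm_eq_abs]
      ring
  have h := hmain.comp_div (R := 2 * Real.pi) (by positivity)
  refine h.congr (Filter.Eventually.of_forall fun t => ?_)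
  simp only
  rw [bdbH_eq, abs_div, abs_of_pos (show 0 < 2 * Real.pi by positivity), hc]
  congr 3
  field_simp
  ring

lemma bdb_cs (μ₁ μ₂ : Measure ℝ) [IsFiniteMeasure μ₁] [IsFiniteMeasure μ₂]
    (s : ℝ) (hs : 1 / 2 < s) (φ : SchwartzMap ℝ ℂ) :
    ∫ t : ℝ, ‖bdbH φ t‖ * ‖bdbA μ₁ μ₂ t‖
      ≤ (∫ t : ℝ, (1 + 2 * |t|) ^ (2 * s) * ‖bdbH φ t‖ ^ 2) ^ (1 / 2 : ℝ)
        * (∫ t : ℝ, (1 + 2 * |t|) ^ (-(2 * s)) * ‖bdbA μ₁ μ₂ t‖ ^ 2) ^ (1 / 2 : ℝ) := by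
  have hA := bdbA_continuous μ₁ μ₂
  have hH := bdbH_continuous φ
  have hw : ∀ t : ℝ, 0 < 1 + 2 * |t| := fun t => by positivity
  set f : ℝ → ℝ := fun t => (1 + 2 * |t|) ^ s * ‖bdbH φ t‖ with hf
  set g : ℝ → ℝ := fun t => (1 + 2 * |t|) ^ (-s) * ‖bdbA μ₁ μ₂ t‖ with hg
  have hfm : Measurable f := by
    have := hH.measurable
    fun_prop
  have hgm : Measurable g := by
    have := hA.measurable
    fun_prop
  have hsq : ∀ (r t : ℝ), ((1 + 2 * |t|) ^ r) ^ 2 = (1 + 2 * |t|) ^ (2 * r) := by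
    intro r t
    rw [← Real.rpow_natCast, ← Real.rpow_mul (hw t).le]
    congr 1; push_cast; ring
  have hf2 : ∀ t, f t ^ 2 = (1 + 2 * |t|) ^ (2 * s) * ‖bdbH φ t‖ ^ 2 := by
    intro t; simp only [hf]; rw [mul_pow, hsq]
  have hg2 : ∀ t, g t ^ 2 = (1 + 2 * |t|) ^ (-(2 * s)) * ‖bdbA μ₁ μ₂ t‖ ^ 2 := by
    intro t; simp only [hg]; rw [mul_pow, hsq, mul_neg]
  have hfL : MemLp f 2 := by
    rw [memLp_two_iff_integrable_sq hfm.aestronglyMeasurable]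
    simp_rw [hf2]
    exact bdb_Hs_integrable s hs φ
  have hgL : MemLp g 2 := by
    rw [memLp_two_iff_integrable_sq hgm.aestronglyMeasurable]
    refine ((bdb_integrable_weight s hs).const_mul
      ((μ₁.real Set.univ + μ₂.real Set.univ) ^ 2)).mono' (hgm.pow_const 2).aestronglyMeasurable
      (Filter.Eventually.of_forall fun t => ?_)
    rw [hg2, Real.norm_eq_abs, abs_of_nonneg (by positivity), mul_comm]
    gcongr
    exact bdbA_bound _ _ _
  have h := integral_mul_le_Lp_mul_Lq_of_nonneg (μ := volume) (p := 2) (q := 2) Real.HolderConjugate.two_two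
    (f := f) (g := g)
    (Filter.Eventually.of_forall fun t => by simp only [hf, Pi.zero_apply]; positivity)
    (Filter.Eventually.of_forall fun t => by simp only [hg, Pi.zero_apply]; positivity)
    (by simpa using hfL) (by simpa using hgL)
  simp_rw [Real.rpow_two, hf2, hg2] at h
  refine le_trans (le_of_eq ?_) h
  congr 1
  ext t
  simp only [hf, hg]
  rw [Real.rpow_neg (hw t).le]
  have := (Real.rpow_pos_of_pos (hw t) s).ne'
  field_simp


/-- Duality bound for linear statistics of a finite signed measure `μ′ = μ₁ − μ₂`:
for `s > 1/2` and a Schwartz function `φ`,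
`|∫ φ dμ′| ≤ ‖φ‖_{H_s}/(2π^{3/2}Γ(2s)^{1/2}) (∫₀^∞ e^{−y} y^{2s−1} ∫ |β(x+iy)|² dx dy)^{1/2}`,
where `β(z) = ∫ dμ′(t)/(z−t)` and `‖φ‖_{H_s}² = ∫ (1+2|t|)^{2s}|φ̂(t)|² dt` with
`φ̂(t) = ∫ e^{−itx} φ(x) dx`. -/
theorem bias_duality_bound (μ₁ μ₂ : Measure ℝ) [IsFiniteMeasure μ₁] [IsFiniteMeasure μ₂]
    (s : ℝ) (hs : 1 / 2 < s) (φ : SchwartzMap ℝ ℂ) :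
    ‖(∫ x : ℝ, φ x ∂μ₁) - ∫ x : ℝ, φ x ∂μ₂‖
      ≤ ((∫ t : ℝ, (1 + 2 * |t|) ^ (2 * s)
            * ‖∫ x : ℝ, Complex.exp (-Complex.I * (t : ℂ) * (x : ℂ)) * φ x‖ ^ 2) ^ (1 / 2 : ℝ)
          / (2 * Real.pi ^ (3 / 2 : ℝ) * Real.Gamma (2 * s) ^ (1 / 2 : ℝ)))
        * (∫ y in Set.Ioi (0 : ℝ), Real.exp (-y) * y ^ (2 * s - 1)
            * ∫ x : ℝ, ‖(∫ t : ℝ, ((x : ℂ) + y * Complex.I - (t : ℂ))⁻¹ ∂μ₁)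
                - ∫ t : ℝ, ((x : ℂ) + y * Complex.I - (t : ℂ))⁻¹ ∂μ₂‖ ^ 2) ^ (1 / 2 : ℝ) := by
  have h1 := bdb_pair_bound μ₁ μ₂ φ
  have h2 := bdb_cs μ₁ μ₂ s hs φ
  rw [bdb_beta μ₁ μ₂ s hs]
  change _ ≤ ((∫ t : ℝ, (1 + 2 * |t|) ^ (2 * s) * ‖bdbH φ t‖ ^ 2) ^ (1 / 2 : ℝ) / _) * _
  set P := (∫ t : ℝ, (1 + 2 * |t|) ^ (2 * s) * ‖bdbH φ t‖ ^ 2) ^ (1 / 2 : ℝ) with hP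
  have hQ0 : 0 ≤ ∫ t : ℝ, (1 + 2 * |t|) ^ (-(2 * s)) * ‖bdbA μ₁ μ₂ t‖ ^ 2 :=
    integral_nonneg fun t => by positivity
  set Q := ∫ t : ℝ, (1 + 2 * |t|) ^ (-(2 * s)) * ‖bdbA μ₁ μ₂ t‖ ^ 2 with hQ
  have hG : 0 < Real.Gamma (2 * s) := Real.Gamma_pos_of_pos (by linarith)
  have hG' : 0 < Real.Gamma (2 * s) ^ (1 / 2 : ℝ) := Real.rpow_pos_of_pos hG _
  have hpi := Real.pi_pos
  have hpi' : 0 < Real.pi ^ (1 / 2 : ℝ) := Real.rpow_pos_of_pos hpi _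
  rw [Real.mul_rpow (by positivity) hQ0, Real.mul_rpow hpi.le hG.le]
  have h3 : Real.pi ^ (3 / 2 : ℝ) = Real.pi * Real.pi ^ (1 / 2 : ℝ) := by
    rw [show (3 / 2 : ℝ) = 1 + 1 / 2 by norm_num, Real.rpow_add hpi, Real.rpow_one]
  rw [h3]
  calc _ ≤ (2 * Real.pi)⁻¹ * (P * Q ^ (1 / 2 : ℝ)) := h1.trans (by gcongr)
    _ = _ := by
        field_simp
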